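/- Let a, n be positive integers with a < n and gcd(a,n) = 1. If a = 1, then L(S_1) = (1,1) and H(S_1) = (1, n−1). If a > 1, then: for 2 ≤ k ≤ a−1, L(S_k) = (k, ⌈(k−1)n/a⌉) and H(S_k) = (k, ⌊kn/a⌋); moreover L(S_1) = (1,1), H(S_1) = (1, ⌊n/a⌋), L(S_a) = (a, ⌈(a−1)n/a⌉), and H(S_a) = (a, n−1). -/

import Mathlib

/-- The set of lattice points of `ℝ²`. -/
def latt : Set (ℝ × ℝ) := {p | ∃ z : ℤ × ℤ, p = ((z.1 : ℝ), (z.2 : ℝ))}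

/-- The clean lattice parallelogram with vertices `(0,0), (1,0), (a,n), (a+1,n)`. -/
noncomputable def Pan (a n : ℕ) : Set (ℝ × ℝ) :=
  convexHull ℝ ({(0, 0), (1, 0), ((a : ℝ), (n : ℝ)), ((a : ℝ) + 1, (n : ℝ))} : Set (ℝ × ℝ))

/-- `S_k`: the lattice points in the interior of `P_{a,n}` with `x`-coordinate `k`. -/
noncomputable def Sk (a n k : ℕ) : Set (ℝ × ℝ) :=
  {p | p ∈ interior (Pan a n) ∧ p ∈ latt ∧ p.1 = (k : ℝ)}

/-- `p = L(S_k)`: the point of `S_k` with smallest `y`-coordinate. -/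
noncomputable def IsLowest (a n k : ℕ) (p : ℝ × ℝ) : Prop :=
  p ∈ Sk a n k ∧ ∀ q ∈ Sk a n k, p.2 ≤ q.2

/-- `p = H(S_k)`: the point of `S_k` with largest `y`-coordinate. -/
noncomputable def IsHighest (a n k : ℕ) (p : ℝ × ℝ) : Prop :=
  p ∈ Sk a n k ∧ ∀ q ∈ Sk a n k, q.2 ≤ p.2

/-- The shear `(x, y) ↦ (y, n x - a y)`, which maps `Pan a n` onto the square `[0, n] × [0, n]`. -/
noncomputable def shearHomeomorph (a n : ℝ) (hn : n ≠ 0) : (ℝ × ℝ) ≃ₜ (ℝ × ℝ) where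
  toFun p := (p.2, n * p.1 - a * p.2)
  invFun q := ((q.2 + a * q.1) / n, q.1)
  left_inv p := by
    ext
    · simp [hn]
    · simp
  right_inv q := by
    ext
    · simp
    · simp only
      field_simp
      ring
  continuous_toFun := by fun_prop
  continuous_invFun := by fun_prop

theorem shearHomeomorph_apply (a n : ℝ) (hn : n ≠ 0) (p : ℝ × ℝ) :
    shearHomeomorph a n hn p = (p.2, n * p.1 - a * p.2) :=
  rfl

theorem Pan_eq_preimage (a n : ℕ) (hn : (n : ℝ) ≠ 0) :
    Pan a n = shearHomeomorph a n hn ⁻¹' (Set.Icc 0 (n : ℝ) ×ˢ Set.Icc 0 (n : ℝ)) := by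
  have hpos : (0 : ℝ) < n := lt_of_le_of_ne (Nat.cast_nonneg n) hn.symm
  apply Set.Subset.antisymm
  · apply convexHull_min
    · rintro p (rfl | rfl | rfl | rfl) <;>
        simp only [shearHomeomorph_apply, Set.mem_preimage,
          Set.mem_prod, Set.mem_Icc] <;>
        refine ⟨⟨?_, ?_⟩, ?_, ?_⟩ <;> nlinarith
    · rintro ⟨x, y⟩ hp ⟨z, w⟩ hq s t hs ht hst
      simp only [shearHomeomorph_apply, Set.mem_preimage,
        Set.mem_prod, Set.mem_Icc, Prod.smul_mk, Prod.mk_add_mk, smul_eq_mul] at hp hq ⊢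
      obtain ⟨⟨h1, h2⟩, h3, h4⟩ := hp
      obtain ⟨⟨k1, k2⟩, k3, k4⟩ := hq
      obtain rfl : t = 1 - s := by linarith
      refine ⟨⟨?_, ?_⟩, ?_, ?_⟩
      · nlinarith [mul_nonneg hs h1, mul_nonneg ht k1]
      · nlinarith [mul_le_mul_of_nonneg_left h2 hs, mul_le_mul_of_nonneg_left k2 ht]
      · nlinarith [mul_nonneg hs h3, mul_nonneg ht k3]
      · nlinarith [mul_le_mul_of_nonneg_left h4 hs, mul_le_mul_of_nonneg_left k4 ht]
  · rintro ⟨x, y⟩ hp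
    simp only [shearHomeomorph_apply, Set.mem_preimage,
      Set.mem_prod, Set.mem_Icc] at hp
    obtain ⟨⟨h1, h2⟩, h3, h4⟩ := hp
    have hc : Convex ℝ (Pan a n) := convex_convexHull ℝ _
    have hv := subset_convexHull ℝ
      ({(0, 0), (1, 0), ((a : ℝ), (n : ℝ)), ((a : ℝ) + 1, (n : ℝ))} : Set (ℝ × ℝ))
    have v1 : ((0, 0) : ℝ × ℝ) ∈ Pan a n := hv (by simp)
    have v2 : ((1, 0) : ℝ × ℝ) ∈ Pan a n := hv (by simp)
    have v3 : ((a, n) : ℝ × ℝ) ∈ Pan a n := hv (by simp)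
    have v4 : ((a + 1, n) : ℝ × ℝ) ∈ Pan a n := hv (by simp)
    have ht0 : 0 ≤ (n * x - a * y) / n := div_nonneg h3 hpos.le
    have ht1 : 0 ≤ 1 - (n * x - a * y) / n := sub_nonneg.2 ((div_le_one hpos).2 h4)
    have hs0 : 0 ≤ y / n := div_nonneg h1 hpos.le
    have hs1 : 0 ≤ 1 - y / n := sub_nonneg.2 ((div_le_one hpos).2 h2)
    have key := hc (hc v1 v2 ht1 ht0 (by ring)) (hc v3 v4 ht1 ht0 (by ring)) hs1 hs0 (by ring)
    convert key using 1
    ext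
    · simp only [Prod.smul_mk, Prod.mk_add_mk, smul_eq_mul]
      field_simp
      ring
    · simp only [Prod.smul_mk, Prod.mk_add_mk, smul_eq_mul]
      field_simp
      ring

theorem mem_interior_Pan (a n : ℕ) (hn : 0 < n) (p : ℝ × ℝ) :
    p ∈ interior (Pan a n) ↔
      (0 < p.2 ∧ p.2 < n) ∧ 0 < n * p.1 - a * p.2 ∧ n * p.1 - a * p.2 < n := by
  rw [Pan_eq_preimage a n (by positivity), ← Homeomorph.preimage_interior, interior_prod_eq,
    interior_Icc]
  rfl

theorem mem_Sk_iff (a n k : ℕ) (hn : 0 < n) (p : ℝ × ℝ) :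
    p ∈ Sk a n k ↔ ∃ y : ℤ, p = ((k : ℝ), (y : ℝ)) ∧
      (0 < y ∧ y < n) ∧ 0 < (n : ℤ) * k - a * y ∧ (n : ℤ) * k - a * y < n := by
  simp only [Sk, Set.mem_ofPred_eq, mem_interior_Pan a n hn, latt]
  constructor
  · rintro ⟨h, ⟨⟨x, y⟩, rfl⟩, hx⟩
    simp only at h hx
    rw [hx] at h
    exact ⟨y, by rw [hx], by exact_mod_cast h⟩
  · rintro ⟨y, rfl, h⟩
    exact ⟨by dsimp only; exact_mod_cast h, ⟨(k, y), by simp⟩, rfl⟩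

theorem isLowest_iff (a n k : ℕ) (hn : 0 < n) (y : ℤ) :
    IsLowest a n k ((k : ℝ), (y : ℝ)) ↔
      ((0 < y ∧ y < n) ∧ 0 < (n : ℤ) * k - a * y ∧ (n : ℤ) * k - a * y < n) ∧
      ∀ z : ℤ, 0 < z → z < n → 0 < (n : ℤ) * k - a * z → (n : ℤ) * k - a * z < n → y ≤ z := by
  simp only [IsLowest, mem_Sk_iff a n k hn]
  constructor
  · rintro ⟨⟨w, hw, h⟩, hl⟩
    obtain rfl : y = w := by simpa using hw
    exact ⟨h, fun z h1 h2 h3 h4 => by simpa using hl _ ⟨z, rfl, ⟨h1, h2⟩, h3, h4⟩⟩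
  · rintro ⟨h, hl⟩
    refine ⟨⟨y, rfl, h⟩, ?_⟩
    rintro _ ⟨z, rfl, ⟨h1, h2⟩, h3, h4⟩
    exact Int.cast_le.2 <| hl z h1 h2 h3 h4

theorem isHighest_iff (a n k : ℕ) (hn : 0 < n) (y : ℤ) :
    IsHighest a n k ((k : ℝ), (y : ℝ)) ↔
      ((0 < y ∧ y < n) ∧ 0 < (n : ℤ) * k - a * y ∧ (n : ℤ) * k - a * y < n) ∧
      ∀ z : ℤ, 0 < z → z < n → 0 < (n : ℤ) * k - a * z → (n : ℤ) * k - a * z < n → z ≤ y := by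
  simp only [IsHighest, mem_Sk_iff a n k hn]
  constructor
  · rintro ⟨⟨w, hw, h⟩, hl⟩
    obtain rfl : y = w := by simpa using hw
    exact ⟨h, fun z h1 h2 h3 h4 => by simpa using hl _ ⟨z, rfl, ⟨h1, h2⟩, h3, h4⟩⟩
  · rintro ⟨h, hl⟩
    refine ⟨⟨y, rfl, h⟩, ?_⟩
    rintro _ ⟨z, rfl, ⟨h1, h2⟩, h3, h4⟩
    exact Int.cast_le.2 <| hl z h1 h2 h3 h4

theorem mul_ne_mul_of_coprime {a n k : ℕ} (hco : Nat.Coprime a n) (hk : 0 < k) (hka : k < a)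
    (y : ℤ) : (a : ℤ) * y ≠ k * n := by
  intro h
  have hd : (a : ℤ) ∣ ((k * n : ℕ) : ℤ) := ⟨y, by rw [h]; push_cast; ring⟩
  exact Nat.not_dvd_of_pos_of_lt hk hka (hco.dvd_of_dvd_mul_right (Int.natCast_dvd_natCast.1 hd))

theorem isLowest_ceil {a n k : ℕ} (han : a < n) (hco : Nat.Coprime a n) (hk : 2 ≤ k)
    (hka : k ≤ a) :
    IsLowest a n k ((k : ℝ), ((⌈(((k : ℝ) - 1) * (n : ℝ)) / (a : ℝ)⌉ : ℤ) : ℝ)) := by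
  have ha : (0 : ℝ) < a := by exact_mod_cast (by omega : 0 < a)
  obtain ⟨y, hy⟩ : ∃ y : ℤ, y = ⌈(((k : ℝ) - 1) * (n : ℝ)) / (a : ℝ)⌉ := ⟨_, rfl⟩
  rw [← hy, isLowest_iff a n k (by omega)]
  obtain ⟨h1, h2⟩ := Int.ceil_eq_iff.1 hy.symm
  rw [lt_div_iff₀ ha] at h1
  rw [div_le_iff₀ ha] at h2
  have h1' : (y - 1) * (a : ℤ) < (k - 1) * n := by exact_mod_cast h1
  have h2' : ((k : ℤ) - 1) * n ≤ y * a := by exact_mod_cast h2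
  have hne := mul_ne_mul_of_coprime hco (k := k - 1) (by omega) (by omega) y
  push_cast [show 1 ≤ k by omega] at hne
  have h3 : ((k : ℤ) - 1) * n < y * a := lt_of_le_of_ne h2' (by rw [mul_comm y]; exact hne.symm)
  zify at han hk hka
  have hypos : 0 < y := by
    by_contra! h
    nlinarith
  refine ⟨⟨⟨hypos, ?_⟩, ?_, ?_⟩, fun z _ _ _ h => ?_⟩
  · by_contra! h
    nlinarith
  · nlinarith
  · nlinarith
  · by_contra! hz
    nlinarith

theorem isHighest_floor {a n k : ℕ} (han : a < n) (hco : Nat.Coprime a n) (hk : 1 ≤ k)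
    (hka : k < a) :
    IsHighest a n k ((k : ℝ), ((⌊((k : ℝ) * (n : ℝ)) / (a : ℝ)⌋ : ℤ) : ℝ)) := by
  have ha : (0 : ℝ) < a := by exact_mod_cast (by omega : 0 < a)
  obtain ⟨y, hy⟩ : ∃ y : ℤ, y = ⌊((k : ℝ) * (n : ℝ)) / (a : ℝ)⌋ := ⟨_, rfl⟩
  rw [← hy, isHighest_iff a n k (by omega)]
  obtain ⟨h1, h2⟩ := Int.floor_eq_iff.1 hy.symm
  rw [div_lt_iff₀ ha] at h2
  rw [le_div_iff₀ ha] at h1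
  have h1' : y * (a : ℤ) ≤ k * n := by exact_mod_cast h1
  have h2' : (k : ℤ) * n < (y + 1) * a := by exact_mod_cast h2
  have hne := mul_ne_mul_of_coprime hco (by omega) hka y
  have h3 : y * a < (k : ℤ) * n := lt_of_le_of_ne h1' (by rw [mul_comm y]; exact hne)
  zify at han hk hka
  refine ⟨⟨⟨?_, ?_⟩, ?_, ?_⟩, fun z _ _ h _ => ?_⟩
  · by_contra! h
    nlinarith
  · by_contra! h
    nlinarith
  · nlinarith
  · nlinarith
  · by_contra! hz
    nlinarith

theorem isLowest_one {a n : ℕ} (ha : 0 < a) (han : a < n) : IsLowest a n 1 (1, 1) := by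
  have h := (isLowest_iff a n 1 (by omega) 1).2
    ⟨⟨⟨by omega, by omega⟩, by push_cast; omega, by push_cast; omega⟩, fun z hz _ _ _ => hz⟩
  simpa using h

theorem isHighest_self {a n : ℕ} (ha : 0 < a) (han : a < n) :
    IsHighest a n a ((a : ℝ), (n : ℝ) - 1) := by
  have h := (isHighest_iff a n a (by omega) (n - 1)).2
    ⟨⟨⟨by omega, by omega⟩, by linarith, by linarith⟩, fun z _ hz _ _ => by omega⟩
  simpa using h

/-- Explicit description of the lowest and highest points `L(S_k)`, `H(S_k)` of the columns
of interior lattice points of `P_{a,n}`. -/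
theorem stmt_7 (a n : ℕ) (ha : 0 < a) (han : a < n) (hco : Nat.Coprime a n) :
    (a = 1 → IsLowest a n 1 (1, 1) ∧ IsHighest a n 1 (1, (n : ℝ) - 1)) ∧
    (1 < a →
      (∀ k : ℕ, 2 ≤ k → k ≤ a - 1 →
        IsLowest a n k ((k : ℝ), ((⌈(((k : ℝ) - 1) * (n : ℝ)) / (a : ℝ)⌉ : ℤ) : ℝ)) ∧
        IsHighest a n k ((k : ℝ), ((⌊((k : ℝ) * (n : ℝ)) / (a : ℝ)⌋ : ℤ) : ℝ))) ∧
      IsLowest a n 1 (1, 1) ∧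
      IsHighest a n 1 (1, ((⌊(n : ℝ) / (a : ℝ)⌋ : ℤ) : ℝ)) ∧
      IsLowest a n a ((a : ℝ), ((⌈(((a : ℝ) - 1) * (n : ℝ)) / (a : ℝ)⌉ : ℤ) : ℝ)) ∧
      IsHighest a n a ((a : ℝ), (n : ℝ) - 1)) := by
  refine ⟨?_, fun h1 => ⟨fun k hk hka => ⟨?_, ?_⟩, isLowest_one ha han, ?_, ?_,
    isHighest_self ha han⟩⟩
  · rintro rfl
    exact ⟨isLowest_one ha han, by simpa using isHighest_self ha han⟩
  · exact isLowest_ceil han hco hk (by omega)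
  · exact isHighest_floor han hco (by omega) (by omega)
  · simpa using isHighest_floor han hco le_rfl h1
  · exact isLowest_ceil han hco h1 le_rfl
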